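/- Assume q ≠ 0, let V ∈ ℝ^{n×(n−1)} have orthonormal columns spanning {q}^⊥, and let H_q = VᵀHV be positive definite. Let x* be a stationary point of the problem min f(x) subject to x ∈ Ω. Then for every x ∈ Ω: f(x) − f(x*) ≥ (1/2)·ζ_min(H_q)·‖x − x*‖². In particular, x* is the unique global minimizer of f over Ω. -/

import Mathlib

noncomputable section

open Matrix
open scoped Classical

/-- Euclidean dot product. -/
def dotp {m : Type*} [Fintype m] (v w : m → ℝ) : ℝ := ∑ i, v i * w i

/-- Euclidean norm. -/
def nrm {m : Type*} [Fintype m] (v : m → ℝ) : ℝ := Real.sqrt (∑ i, (v i) ^ 2)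

/-- Objective f(x) = ½ xᵀHx − cᵀx. -/
def fObj {n : ℕ} (H : Matrix (Fin n) (Fin n) ℝ) (c x : Fin n → ℝ) : ℝ :=
  (1 / 2) * dotp x (H.mulVec x) - dotp c x

/-- Gradient ∇f(x) = Hx − c (for H symmetric). -/
def grad {n : ℕ} (H : Matrix (Fin n) (Fin n) ℝ) (c x : Fin n → ℝ) : Fin n → ℝ :=
  H.mulVec x - c

/-- Feasible set Ω = {x : qᵀx = b, l ≤ x ≤ u}. -/
def OmegaSet {n : ℕ} (q : Fin n → ℝ) (b : ℝ) (l u : Fin n → ℝ) : Set (Fin n → ℝ) :=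
  {x | dotp q x = b ∧ ∀ i, l i ≤ x i ∧ x i ≤ u i}

/-- Lower active set A_l(x). -/
def Al {n : ℕ} (l x : Fin n → ℝ) : Set (Fin n) := {i | x i = l i}

/-- Upper active set A_u(x). -/
def Au {n : ℕ} (u x : Fin n → ℝ) : Set (Fin n) := {i | x i = u i}

/-- Active set A(x). -/
def ASet {n : ℕ} (l u x : Fin n → ℝ) : Set (Fin n) := Al l x ∪ Au u x

/-- Free set F(x). -/
def FSet {n : ℕ} (l u x : Fin n → ℝ) : Set (Fin n) := (ASet l u x)ᶜ

/-- ρ(x) = q_Fᵀ(∇f(x))_F / q_Fᵀq_F (0 if q_F = 0). -/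
def rhoF {n : ℕ} (H : Matrix (Fin n) (Fin n) ℝ) (c q l u x : Fin n → ℝ) : ℝ :=
  if ∀ i ∈ FSet l u x, q i = 0 then 0
  else (∑ i, if i ∈ FSet l u x then q i * grad H c x i else 0) /
    (∑ i, if i ∈ FSet l u x then q i * q i else 0)

/-- h(x) = ∇f(x) − ρ(x) q. -/
def hVec {n : ℕ} (H : Matrix (Fin n) (Fin n) ℝ) (c q l u x : Fin n → ℝ) : Fin n → ℝ :=
  fun i => grad H c x i - rhoF H c q l u x * q i

/-- Free gradient φ(x). -/
def phiVec {n : ℕ} (H : Matrix (Fin n) (Fin n) ℝ) (c q l u x : Fin n → ℝ) : Fin n → ℝ :=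
  fun i => if i ∈ FSet l u x then hVec H c q l u x i else 0

/-- Tangent cone T_Ω(x). -/
def TCone {n : ℕ} (q l u x : Fin n → ℝ) : Set (Fin n → ℝ) :=
  {v | dotp q v = 0 ∧ (∀ i ∈ Al l x, 0 ≤ v i) ∧ (∀ i ∈ Au u x, v i ≤ 0)}

/-- g is the projected gradient ∇_Ω f(x): the minimizer of ‖v + ∇f(x)‖ over v ∈ T_Ω(x). -/
def IsProjGrad {n : ℕ} (H : Matrix (Fin n) (Fin n) ℝ) (c q l u x g : Fin n → ℝ) : Prop :=
  g ∈ TCone q l u x ∧ ∀ v ∈ TCone q l u x, nrm (g + grad H c x) ≤ nrm (v + grad H c x)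

/-- Chopped gradient β(x) = −∇_Ω f(x) − φ(x), where g = ∇_Ω f(x). -/
def betaVec {n : ℕ} (H : Matrix (Fin n) (Fin n) ℝ) (c q l u x g : Fin n → ℝ) : Fin n → ℝ :=
  -g - phiVec H c q l u x

/-- Binding set B(x). -/
def BSet {n : ℕ} (H : Matrix (Fin n) (Fin n) ℝ) (c q l u x : Fin n → ℝ) : Set (Fin n) :=
  {i | (i ∈ Al l x ∧ 0 ≤ hVec H c q l u x i) ∨ (i ∈ Au u x ∧ hVec H c q l u x i ≤ 0)}

/-- Affine closure Ω(x) of the face determined by the active set at x. -/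
def OmegaFace {n : ℕ} (q : Fin n → ℝ) (b : ℝ) (l u x : Fin n → ℝ) : Set (Fin n → ℝ) :=
  {v | dotp q v = b ∧ ∀ i ∈ ASet l u x, v i = x i}

/-- Ω₀(x). -/
def Omega0 {n : ℕ} (q l u x : Fin n → ℝ) : Set (Fin n → ℝ) :=
  {v | dotp q v = 0 ∧ ∀ i ∈ ASet l u x, v i = 0}

/-- KKT stationarity: ∇f(x) = Σ_{i∈A(x)} λᵢ eᵢ + ρ q with sign conditions. -/
def Stationary {n : ℕ} (H : Matrix (Fin n) (Fin n) ℝ) (c q : Fin n → ℝ) (b : ℝ)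
    (l u x : Fin n → ℝ) : Prop :=
  x ∈ OmegaSet q b l u ∧
    ∃ (ρs : ℝ) (lam : Fin n → ℝ),
      (∀ i, grad H c x i = lam i + ρs * q i) ∧
      (∀ i ∈ FSet l u x, lam i = 0) ∧
      (∀ i ∈ Al l x, 0 ≤ lam i) ∧ (∀ i ∈ Au u x, lam i ≤ 0)

/-- Lagrange multiplier estimate λ(x). -/
def lamEst {n : ℕ} (H : Matrix (Fin n) (Fin n) ℝ) (c q l u x : Fin n → ℝ) : Fin n → ℝ :=
  fun i =>
    if i ∈ Al l x then max 0 (hVec H c q l u x i)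
    else if i ∈ Au u x then min 0 (hVec H c q l u x i) else 0

/-- ζ is the smallest eigenvalue of M. -/
def IsSmallestEigenvalue {m : Type*} [Fintype m] (M : Matrix m m ℝ) (ζ : ℝ) : Prop :=
  (∃ v : m → ℝ, v ≠ 0 ∧ M.mulVec v = ζ • v) ∧
    ∀ (μ : ℝ) (v : m → ℝ), v ≠ 0 → M.mulVec v = μ • v → ζ ≤ μ

/-- ζ is the largest eigenvalue of M. -/
def IsLargestEigenvalue {m : Type*} [Fintype m] (M : Matrix m m ℝ) (ζ : ℝ) : Prop :=
  (∃ v : m → ℝ, v ≠ 0 ∧ M.mulVec v = ζ • v) ∧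
    ∀ (μ : ℝ) (v : m → ℝ), v ≠ 0 → M.mulVec v = μ • v → μ ≤ ζ

/-- t is the spectral (ℓ₂ operator) norm of M. -/
def IsSpectralNorm {m k : Type*} [Fintype m] [Fintype k] (M : Matrix m k ℝ) (t : ℝ) : Prop :=
  IsLeast {s : ℝ | 0 ≤ s ∧ ∀ v : k → ℝ, nrm (M.mulVec v) ≤ s * nrm v} t

theorem dotp_eq_dotProduct {m : Type*} [Fintype m] (v w : m → ℝ) : dotp v w = v ⬝ᵥ w := rfl

theorem nrm_sq {m : Type*} [Fintype m] (v : m → ℝ) : nrm v ^ 2 = v ⬝ᵥ v := by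
  rw [nrm, Real.sq_sqrt (Finset.sum_nonneg fun i _ => sq_nonneg (v i))]
  simp [dotProduct, sq]

/-- A lower bound for the eigenvalues of a real symmetric matrix bounds its quadratic form. -/
theorem mul_dotProduct_self_le_of_le_eigenvalue {m : Type*} [Fintype m] {M : Matrix m m ℝ}
    (hM : M.IsHermitian) {ζ : ℝ}
    (hζ : ∀ (μ : ℝ) (v : m → ℝ), v ≠ 0 → M *ᵥ v = μ • v → ζ ≤ μ) (w : m → ℝ) :
    ζ * (w ⬝ᵥ w) ≤ w ⬝ᵥ M *ᵥ w := by
  have hN : (M - ζ • (1 : Matrix m m ℝ)).IsHermitian := by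
    refine hM.sub ?_
    simp [Matrix.IsHermitian]
  have hpos : (M - ζ • (1 : Matrix m m ℝ)).PosSemidef := by
    refine hN.posSemidef_iff_eigenvalues_nonneg.mpr fun i => ?_
    have hv := hN.mulVec_eigenvectorBasis i
    rw [sub_mulVec, smul_mulVec, one_mulVec, sub_eq_iff_eq_add, ← add_smul] at hv
    have hne : ⇑(hN.eigenvectorBasis i) ≠ 0 := fun h =>
      hN.eigenvectorBasis.orthonormal.ne_zero i (by ext j; exact congrFun h j)
    have := hζ _ _ hne hv
    simpa using this
  have h := hpos.dotProduct_mulVec_nonneg w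
  rw [sub_mulVec, smul_mulVec, one_mulVec, dotProduct_sub, dotProduct_smul] at h
  simpa using h

/-- `n - 1` orthonormal columns orthogonal to `q ≠ 0` span the hyperplane `{q}ᗮ`. -/
theorem exists_mulVec_eq_of_dotProduct_eq_zero {n : ℕ} {q : Fin n → ℝ} (hq : q ≠ 0)
    {V : Matrix (Fin n) (Fin (n - 1)) ℝ} (hVorth : Vᵀ * V = 1) (hVq : q ᵥ* V = 0)
    {d : Fin n → ℝ} (hd : q ⬝ᵥ d = 0) : ∃ w, V *ᵥ w = d := by
  let φ : Module.Dual ℝ (Fin n → ℝ) := dotProductBilin ℝ ℝ q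
  have hφ : φ ≠ 0 := fun h => hq (dotProduct_self_eq_zero.mp (LinearMap.congr_fun h q))
  have hle : LinearMap.range V.mulVecLin ≤ LinearMap.ker φ := by
    rintro _ ⟨w, rfl⟩
    change q ⬝ᵥ V *ᵥ w = 0
    rw [dotProduct_mulVec, hVq, zero_dotProduct]
  have hinj : Function.Injective V.mulVecLin := fun v w h => by
    have h' : Vᵀ *ᵥ (V *ᵥ v) = Vᵀ *ᵥ (V *ᵥ w) := congrArg (Vᵀ *ᵥ ·) h
    simpa [mulVec_mulVec, hVorth] using h'
  have hker := Module.Dual.finrank_ker_add_one_of_ne_zero hφ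
  have hrange := LinearMap.finrank_range_of_inj hinj
  simp only [Module.finrank_fin_fun] at hker hrange
  have heq := Submodule.eq_of_le_of_finrank_eq hle (by omega)
  have hmem : d ∈ LinearMap.ker φ := hd
  rw [← heq] at hmem
  exact hmem

theorem fObj_sub_fObj {n : ℕ} {H : Matrix (Fin n) (Fin n) ℝ} (hH : H.IsSymm)
    (c x y : Fin n → ℝ) :
    fObj H c x - fObj H c y =
      grad H c y ⬝ᵥ (x - y) + (1 / 2) * ((x - y) ⬝ᵥ H *ᵥ (x - y)) := by
  have hxy : x ⬝ᵥ H *ᵥ y = y ⬝ᵥ H *ᵥ x := by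
    rw [dotProduct_mulVec, ← mulVec_transpose, hH.eq, dotProduct_comm]
  have hg : ∀ z, (H *ᵥ y) ⬝ᵥ z = z ⬝ᵥ H *ᵥ y := fun z => dotProduct_comm _ _
  simp only [fObj, grad, dotp_eq_dotProduct, mulVec_sub, sub_dotProduct, dotProduct_sub, hg]
  linarith

theorem Stationary.grad_dotProduct_sub_nonneg {n : ℕ} {H : Matrix (Fin n) (Fin n) ℝ}
    {c q l u xs : Fin n → ℝ} {b : ℝ} (hstat : Stationary H c q b l u xs)
    {x : Fin n → ℝ} (hx : x ∈ OmegaSet q b l u) : 0 ≤ grad H c xs ⬝ᵥ (x - xs) := by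
  obtain ⟨⟨hqs, -⟩, ρ, lam, hgrad, hfree, hl, hu⟩ := hstat
  obtain ⟨hqx, hbox⟩ := hx
  have hg : grad H c xs = lam + ρ • q := funext hgrad
  rw [dotp_eq_dotProduct] at hqs hqx
  rw [hg, add_dotProduct, smul_dotProduct, dotProduct_sub q, hqx, hqs, sub_self, smul_zero,
    add_zero]
  refine Finset.sum_nonneg fun i _ => ?_
  by_cases hil : i ∈ Al l xs
  · have : xs i = l i := hil
    exact mul_nonneg (hl i hil) (by simpa [this] using (hbox i).1)
  by_cases hiu : i ∈ Au u xs
  · have : xs i = u i := hiu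
    exact mul_nonneg_of_nonpos_of_nonpos (hu i hiu) (by simpa [this] using (hbox i).2)
  · rw [hfree i (by simp [FSet, ASet, hil, hiu]), zero_mul]

/-- f(x) − f(x*) ≥ ½ ζ_min(H_q) ‖x − x*‖² for all x ∈ Ω;
in particular x* is the unique global minimizer of f over Ω. -/
theorem stmt_16 {n : ℕ} (hn : 2 ≤ n)
    (H : Matrix (Fin n) (Fin n) ℝ) (hH : H.IsSymm)
    (c q l u : Fin n → ℝ) (b : ℝ) (hlu : ∀ i, l i < u i) (hq : q ≠ 0)
    (V : Matrix (Fin n) (Fin (n - 1)) ℝ)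
    (hVorth : Vᵀ * V = 1) (hVq : Matrix.vecMul q V = 0)
    (hHq : (Vᵀ * H * V).PosDef)
    (ζ : ℝ) (hζ : IsSmallestEigenvalue (Vᵀ * H * V) ζ)
    (xs : Fin n → ℝ) (hstat : Stationary H c q b l u xs) :
    (∀ x ∈ OmegaSet q b l u,
        fObj H c x - fObj H c xs ≥ (1 / 2) * ζ * nrm (x - xs) ^ 2) ∧
      (∀ x ∈ OmegaSet q b l u, fObj H c xs ≤ fObj H c x) ∧
      (∀ x ∈ OmegaSet q b l u, (∀ y ∈ OmegaSet q b l u, fObj H c x ≤ fObj H c y) → x = xs) := by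
  have hgrowth : ∀ x ∈ OmegaSet q b l u,
      fObj H c x - fObj H c xs ≥ (1 / 2) * ζ * nrm (x - xs) ^ 2 := by
    intro x hx
    have hd : q ⬝ᵥ (x - xs) = 0 := by
      rw [dotProduct_sub, ← dotp_eq_dotProduct, ← dotp_eq_dotProduct, hx.1, hstat.1.1, sub_self]
    obtain ⟨w, hw⟩ := exists_mulVec_eq_of_dotProduct_eq_zero hq hVorth hVq hd
    have hray := mul_dotProduct_self_le_of_le_eigenvalue hHq.isHermitian hζ.2 w
    have hVV : ∀ z, (V *ᵥ w) ⬝ᵥ z = w ⬝ᵥ Vᵀ *ᵥ z := fun z => by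
      rw [dotProduct_mulVec w, vecMul_transpose]
    have hquad : w ⬝ᵥ (Vᵀ * H * V) *ᵥ w = (x - xs) ⬝ᵥ H *ᵥ (x - xs) := by
      rw [← hw, hVV, mulVec_mulVec, mulVec_mulVec]
    have hnorm : w ⬝ᵥ w = nrm (x - xs) ^ 2 := by
      rw [nrm_sq, ← hw, hVV, mulVec_mulVec, hVorth, one_mulVec]
    rw [hquad, hnorm] at hray
    have hfirst := hstat.grad_dotProduct_sub_nonneg hx
    rw [fObj_sub_fObj hH]
    linarith
  have hζpos : 0 < ζ := by
    obtain ⟨v, hv, hMv⟩ := hζ.1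
    have h := hHq.dotProduct_mulVec_pos hv
    rw [hMv, star_trivial, dotProduct_smul, smul_eq_mul] at h
    exact pos_of_mul_pos_left h (dotProduct_self_star_nonneg v)
  refine ⟨hgrowth, fun x hx => ?_, fun x hx hmin => ?_⟩
  · have : 0 ≤ (1 / 2) * ζ * nrm (x - xs) ^ 2 := by positivity
    linarith [hgrowth x hx]
  · have h1 := hgrowth x hx
    have h2 := hmin xs hstat.1
    have h3 : (1 / 2) * ζ * nrm (x - xs) ^ 2 ≤ 0 := by linarith
    have h4 : nrm (x - xs) ^ 2 ≤ 0 := nonpos_of_mul_nonpos_right h3 (by positivity)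
    rw [nrm_sq] at h4
    exact sub_eq_zero.mp
      (dotProduct_self_eq_zero.mp (le_antisymm h4 (dotProduct_self_star_nonneg _)))
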